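/- Let n ∈ ℕ, m ≥ 1 an integer, and f : 𝔽₂ⁿ → 𝔽₂. Then the m-Hadamard transform is invertible: for every y ∈ 𝔽₂ⁿ, (-1)^(f(y)) = 2^(-n/2) · ζ_m^(−wt(y)) · ∑_{ω ∈ 𝔽₂ⁿ} H^(m)_f(ω) · (-1)^(ω·y). -/

import Mathlib

open Finset

noncomputable section

/-- Sign character: `(-1)^v ∈ ℂ` for `v ∈ 𝔽₂`. -/
def sgn (v : ZMod 2) : ℂ := if v = 0 then 1 else -1

/-- Hamming weight of `x ∈ 𝔽₂ⁿ`. -/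
def wt {n : ℕ} (x : Fin n → ZMod 2) : ℕ := (Finset.univ.filter (fun i => x i = 1)).card

/-- Dot product `x·y = ⊕ᵢ xᵢyᵢ ∈ 𝔽₂`. -/
def dotp {n : ℕ} (x y : Fin n → ZMod 2) : ZMod 2 := ∑ i, x i * y i

/-- `x⊙y ∈ ℕ`: number of indices with `xᵢ = yᵢ = 1`. -/
def odot {n : ℕ} (x y : Fin n → ZMod 2) : ℕ :=
  (Finset.univ.filter (fun i => x i = 1 ∧ y i = 1)).card

/-- `ζ_m = exp(2πi/m)`. -/
def zeta (m : ℕ) : ℂ := Complex.exp (2 * Real.pi * Complex.I / m)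

/-- The `m`-Hadamard transform of `f` at `ω`. -/
def mHad (m : ℕ) {n : ℕ} (f : (Fin n → ZMod 2) → ZMod 2) (ω : Fin n → ZMod 2) : ℂ :=
  ((Real.sqrt 2 : ℂ) ^ n)⁻¹ *
    ∑ x : Fin n → ZMod 2, sgn (f x + dotp x ω) * zeta m ^ wt x

/-- The `m`-crosscorrelation of `f` and `g` at `y`. -/
def mCross (m : ℕ) {n : ℕ} (f g : (Fin n → ZMod 2) → ZMod 2) (y : Fin n → ZMod 2) : ℂ :=
  ∑ x : Fin n → ZMod 2, sgn (f x + g (x + y)) * (zeta m ^ 2) ^ odot x y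

/-- The (3-fold) `m`-Forrelation of `f₁, f₂, f₃`. -/
def mForr (m : ℕ) {n : ℕ} (f₁ f₂ f₃ : (Fin n → ZMod 2) → ZMod 2) : ℂ :=
  ((2 : ℂ) ^ n)⁻¹ *
    ∑ x : Fin n → ZMod 2, sgn (f₁ x) * mHad m f₂ x * (starRingEnd ℂ) (mHad m f₃ x)

/-- The Walsh–Hadamard transform of `f` at `ω`. -/
def walsh {n : ℕ} (f : (Fin n → ZMod 2) → ZMod 2) (ω : Fin n → ZMod 2) : ℂ :=
  ((Real.sqrt 2 : ℂ) ^ n)⁻¹ * ∑ x : Fin n → ZMod 2, sgn (f x + dotp x ω)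

/-- The nega-Hadamard transform of `f` at `ω`. -/
def negaHad {n : ℕ} (f : (Fin n → ZMod 2) → ZMod 2) (ω : Fin n → ZMod 2) : ℂ :=
  ((Real.sqrt 2 : ℂ) ^ n)⁻¹ *
    ∑ x : Fin n → ZMod 2, sgn (f x + dotp x ω) * Complex.I ^ wt x

/-- The elementary symmetric quadratic Boolean function `s₂`. -/
def s2 {n : ℕ} (x : Fin n → ZMod 2) : ZMod 2 :=
  ∑ i : Fin n, ∑ j ∈ Finset.univ.filter (fun j => i < j), x i * x j

/-- The linear function `L_u(x) = ⊕ᵢ xᵢ · (⊕_{j ≠ i} uⱼ)`. -/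
def Lfun {n : ℕ} (u x : Fin n → ZMod 2) : ZMod 2 :=
  ∑ i : Fin n, x i * ∑ j ∈ Finset.univ.filter (fun j => j ≠ i), u j

end

lemma sgn_add' (a b : ZMod 2) : sgn (a + b) = sgn a * sgn b := by
  have h1 : (1 : ZMod 2) + 1 = 0 := by decide
  have hc : ∀ c : ZMod 2, c = 0 ∨ c = 1 := by decide
  rcases hc a with rfl | rfl <;> rcases hc b with rfl | rfl <;> simp [sgn, h1]

lemma sgn_sum' {n : ℕ} (g : Fin n → ZMod 2) : sgn (∑ i, g i) = ∏ i, sgn (g i) := by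
  induction n with
  | zero => simp [sgn]
  | succ k ih => rw [Fin.sum_univ_succ, Fin.prod_univ_succ, sgn_add', ih]

lemma sgn_one_coord (a b : ZMod 2) :
    ∑ w : ZMod 2, sgn (a * w) * sgn (w * b) = if a = b then 2 else 0 := by
  have h : ∀ g : ZMod 2 → ℂ, ∑ w : ZMod 2, g w = g 0 + g 1 := fun g => Fin.sum_univ_two g
  rw [h]
  have hc : ∀ c : ZMod 2, c = 0 ∨ c = 1 := by decide
  rcases hc a with rfl | rfl <;> rcases hc b with rfl | rfl <;> simp [sgn] <;> norm_num

lemma sgn_orth {n : ℕ} (x y : Fin n → ZMod 2) :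
    ∑ ω : Fin n → ZMod 2, sgn (dotp x ω) * sgn (dotp ω y) = if x = y then (2 : ℂ) ^ n else 0 := by
  have h : ∀ ω : Fin n → ZMod 2, sgn (dotp x ω) * sgn (dotp ω y)
      = ∏ i, (sgn (x i * ω i) * sgn (ω i * y i)) := by
    intro ω
    rw [dotp, dotp, sgn_sum', sgn_sum', Finset.prod_mul_distrib]
  simp_rw [h]
  rw [← Fintype.prod_sum (fun i w => sgn (x i * w) * sgn (w * y i))]
  simp_rw [sgn_one_coord]
  split_ifs with hxy
  · subst hxy
    simp
  · obtain ⟨i, hi⟩ := Function.ne_iff.mp hxy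
    exact Finset.prod_eq_zero (Finset.mem_univ i) (by simp [hi])

theorem stmt14 (n m : ℕ) (hm : 1 ≤ m) (f : (Fin n → ZMod 2) → ZMod 2)
    (y : Fin n → ZMod 2) :
    sgn (f y) =
      ((Real.sqrt 2 : ℂ) ^ n)⁻¹ * zeta m ^ (-(wt y : ℤ)) *
        ∑ ω : Fin n → ZMod 2, mHad m f ω * sgn (dotp ω y) := by
  have hz : zeta m ≠ 0 := Complex.exp_ne_zero _
  have hs : (Real.sqrt 2 : ℂ) ^ n * (Real.sqrt 2 : ℂ) ^ n = 2 ^ n := by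
    rw [← mul_pow, ← Complex.ofReal_mul, Real.mul_self_sqrt (by norm_num)]
    norm_num
  have hs0 : (Real.sqrt 2 : ℂ) ^ n ≠ 0 := by
    intro h
    rw [h, zero_mul] at hs
    exact pow_ne_zero n two_ne_zero hs.symm
  have key : ∑ ω : Fin n → ZMod 2, mHad m f ω * sgn (dotp ω y)
      = ((Real.sqrt 2 : ℂ) ^ n)⁻¹ * (sgn (f y) * zeta m ^ wt y * 2 ^ n) := by
    have h1 : ∀ ω : Fin n → ZMod 2, mHad m f ω * sgn (dotp ω y)
        = ((Real.sqrt 2 : ℂ) ^ n)⁻¹ * ∑ x : Fin n → ZMod 2,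
          sgn (f x) * zeta m ^ wt x * (sgn (dotp x ω) * sgn (dotp ω y)) := by
      intro ω
      rw [mHad, mul_assoc, Finset.sum_mul]
      congr 1
      refine Finset.sum_congr rfl fun x _ => ?_
      rw [sgn_add']
      ring
    simp_rw [h1]
    rw [← Finset.mul_sum, Finset.sum_comm]
    simp_rw [← Finset.mul_sum, sgn_orth]
    simp
  rw [key, zpow_neg, zpow_natCast, ← hs]
  field_simp
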